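/- For every set D ⊆ ℕ with D ≤_T ∅' and ∅' ≰_T D, there exists a ∅'-computable martingale M that succeeds on every set A ⊆ ℕ having an infinite subset or an infinite cosubset computable in D. In particular, the class of Δ⁰₂ sets having an infinite subset or cosubset of degree at most deg(D) is Δ⁰₂ null. -/

import Mathlib

/-!
Preamble: oracle computability, Turing reducibility, the jump, martingales,
and Martin-Löf randomness, developed from scratch.
-/

open scoped Classical

/-- The characteristic function of a set of naturals. -/
noncomputable def chi (A : Set ℕ) : ℕ → ℕ :=
  fun n => if n ∈ A then 1 else 0

/-- Partial functions recursive in a (total) oracle `O : ℕ → ℕ`.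
This mirrors `Nat.Partrec`, with an additional constructor for the oracle. -/
inductive RecIn (O : ℕ → ℕ) : (ℕ →. ℕ) → Prop
  | oracle : RecIn O (fun n => Part.some (O n))
  | zero : RecIn O (fun _ => Part.some 0)
  | succ : RecIn O (fun n => Part.some (n + 1))
  | left : RecIn O (fun n => Part.some (Nat.unpair n).1)
  | right : RecIn O (fun n => Part.some (Nat.unpair n).2)
  | pair {f g} : RecIn O f → RecIn O g → RecIn O (fun n => Nat.pair <$> f n <*> g n)
  | comp {f g} : RecIn O f → RecIn O g → RecIn O (fun n => g n >>= f)
  | prec {f g} :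
      RecIn O f → RecIn O g →
      RecIn O
        (Nat.unpaired fun a n =>
          n.rec (f a) fun y IH => do
            let i ← IH
            g (Nat.pair a (Nat.pair y i)))
  | rfind {f} :
      RecIn O f →
      RecIn O (fun a => Nat.rfind fun n => (fun m => m = 0) <$> f (Nat.pair a n))

/-- Codes for oracle machines. -/
inductive OCode : Type
  | zero : OCode
  | succ : OCode
  | left : OCode
  | right : OCode
  | oracle : OCode
  | pair : OCode → OCode → OCode
  | comp : OCode → OCode → OCode
  | prec : OCode → OCode → OCode
  | rfind' : OCode → OCode

/-- Evaluation of oracle codes relative to a total oracle. -/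
def evalo (O : ℕ → ℕ) : OCode → ℕ →. ℕ
  | .zero => fun _ => Part.some 0
  | .succ => fun n => Part.some (n + 1)
  | .left => fun n => Part.some (Nat.unpair n).1
  | .right => fun n => Part.some (Nat.unpair n).2
  | .oracle => fun n => Part.some (O n)
  | .pair cf cg => fun n => Nat.pair <$> evalo O cf n <*> evalo O cg n
  | .comp cf cg => fun n => evalo O cg n >>= evalo O cf
  | .prec cf cg =>
      Nat.unpaired fun a n =>
        n.rec (evalo O cf a) fun y IH => do
          let i ← IH
          evalo O cg (Nat.pair a (Nat.pair y i))
  | .rfind' cf =>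
      Nat.unpaired fun a m =>
        (Nat.rfind fun n => (fun x => x = 0) <$> evalo O cf (Nat.pair a (n + m))).map (· + m)

/-- A surjective listing of oracle codes. -/
def ofNatOCode : ℕ → OCode
  | 0 => .zero
  | 1 => .succ
  | 2 => .left
  | 3 => .right
  | 4 => .oracle
  | n + 5 =>
    have hm : n.div2.div2 < n + 5 := by
      rw [Nat.div2_val, Nat.div2_val]
      exact lt_of_le_of_lt (le_trans (Nat.div_le_self _ _) (Nat.div_le_self _ _))
        (Nat.lt_succ_of_le (Nat.le_add_right _ 4))
    have _m1 : n.div2.div2.unpair.1 < n + 5 :=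
      lt_of_le_of_lt (Nat.unpair_left_le _) hm
    have _m2 : n.div2.div2.unpair.2 < n + 5 :=
      lt_of_le_of_lt (Nat.unpair_right_le _) hm
    match n.bodd, n.div2.bodd with
    | false, false => .pair (ofNatOCode n.div2.div2.unpair.1) (ofNatOCode n.div2.div2.unpair.2)
    | false, true  => .comp (ofNatOCode n.div2.div2.unpair.1) (ofNatOCode n.div2.div2.unpair.2)
    | true , false => .prec (ofNatOCode n.div2.div2.unpair.1) (ofNatOCode n.div2.div2.unpair.2)
    | true , true  => .rfind' (ofNatOCode n.div2.div2)

/-- `Phi O e` is the `e`-th partial `O`-computable function `Φ_e^O`. -/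
def Phi (O : ℕ → ℕ) (e : ℕ) : ℕ →. ℕ := evalo O (ofNatOCode e)

/-- The Turing jump `A'` of a set `A`. -/
noncomputable def jump (A : Set ℕ) : Set ℕ := {e | (Phi (chi A) e e).Dom}

/-- The halting set `∅'`. -/
noncomputable def K : Set ℕ := jump ∅

/-- Turing reducibility between sets: `TRed B A` means `B ≤_T A`. -/
noncomputable def TRed (B A : Set ℕ) : Prop :=
  RecIn (chi A) (fun n => Part.some (chi B n))

/-- The effective join of two sets. -/
def join (A B : Set ℕ) : Set ℕ :=
  {n | (∃ a ∈ A, n = 2 * a) ∨ (∃ b ∈ B, n = 2 * b + 1)}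

/-- A set is low if its jump is Turing reducible to `∅'`. -/
noncomputable def Low (L : Set ℕ) : Prop := TRed (jump L) K

/-- The function `f : α → β` presented as an oracle on `ℕ`, via the encodings. -/
def fnOracle {α β : Type} [Encodable α] [Encodable β] (f : α → β) : ℕ → ℕ :=
  fun n => Encodable.encode ((Encodable.decode (α := α) n).map f)

/-- `FRed f A` means the function `f` is Turing reducible to the set `A`. -/
noncomputable def FRed {α β : Type} [Encodable α] [Encodable β] (f : α → β) (A : Set ℕ) : Prop :=
  RecIn (chi A) (fun n => Part.some (fnOracle f n))

/-- `FFRed g f` means the function `g` is Turing reducible to the function `f`. -/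
def FFRed {α β γ δ : Type} [Encodable α] [Encodable β] [Encodable γ] [Encodable δ]
    (g : γ → δ) (f : α → β) : Prop :=
  RecIn (fnOracle f) (fun n => Part.some (fnOracle g n))

/-- A martingale: a nonnegative rational-valued function on finite binary strings
satisfying the averaging condition `2 M(σ) = M(σ0) + M(σ1)`. -/
def IsMartingale (M : List Bool → ℚ) : Prop :=
  (∀ σ, 0 ≤ M σ) ∧ ∀ σ, 2 * M σ = M (σ ++ [false]) + M (σ ++ [true])

/-- The length-`n` initial segment of the characteristic sequence of `A`. -/
noncomputable def seg (A : Set ℕ) (n : ℕ) : List Bool :=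
  (List.range n).map fun i => if i ∈ A then true else false

/-- A martingale succeeds on a set `A` if `limsup_n M(A↾n) = ∞`. -/
noncomputable def Succeeds (M : List Bool → ℚ) (A : Set ℕ) : Prop :=
  ∀ q : ℚ, ∃ n, q < M (seg A n)

/-- `H(A)`: the mass problem of infinite subsets or cosubsets of `A`. -/
def Hset (A : Set ℕ) : Set (Set ℕ) :=
  {S | S.Infinite ∧ (S ⊆ A ∨ S ⊆ Aᶜ)}

/-- Muchnik reducibility: `MuchnikLe P Q` iff every member of `Q` computes a member of `P`. -/
noncomputable def MuchnikLe (P Q : Set (Set ℕ)) : Prop :=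
  ∀ B ∈ Q, ∃ A ∈ P, TRed A B

/-- A set of naturals is computably enumerable. -/
def CE (W : Set ℕ) : Prop :=
  ∃ g : ℕ →. ℕ, RecIn (fun _ => 0) g ∧ ∀ n, n ∈ W ↔ (g n).Dom

/-- A Martin-Löf test: a uniformly c.e. sequence of sets of strings `U n`,
with the open set generated by `U n` having measure at most `2^{-n}`. -/
def MLTest (U : ℕ → Set (List Bool)) : Prop :=
  CE {p : ℕ | ∃ σ ∈ U (Nat.unpair p).1, (Nat.unpair p).2 = Encodable.encode σ} ∧
  ∀ n, (∑' σ : (U n), ((1 : ENNReal) / 2) ^ (σ : List Bool).length) ≤ (1 / 2) ^ n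

/-- A set is 1-random (Martin-Löf random) if for every Martin-Löf test there is
an `n` such that no initial segment of the set lies in `U n`. -/
noncomputable def MLRandom (A : Set ℕ) : Prop :=
  ∀ U : ℕ → Set (List Bool), MLTest U → ∃ n, ∀ m, seg A m ∉ U n


open Encodable in
theorem recIn_of_partrec (O : ℕ → ℕ) {f : ℕ →. ℕ} (h : Nat.Partrec f) : RecIn O f := by
  induction h with
  | zero => exact RecIn.zero
  | succ => exact RecIn.succ
  | left => exact RecIn.left
  | right => exact RecIn.right
  | pair _ _ h1 h2 => exact RecIn.pair h1 h2
  | comp _ _ h1 h2 => exact RecIn.comp h1 h2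
  | prec _ _ h1 h2 => exact RecIn.prec h1 h2
  | rfind _ h1 => exact RecIn.rfind h1

theorem RecIn.of_eq {O : ℕ → ℕ} {f g : ℕ →. ℕ} (h : RecIn O f) (e : ∀ n, g n = f n) :
    RecIn O g := by
  have : g = f := funext e
  rwa [this]

/-- total functions recursive in O -/
def RT (O : ℕ → ℕ) (f : ℕ → ℕ) : Prop := RecIn O (fun n => Part.some (f n))

theorem RT.of_comp {O : ℕ → ℕ} {f : ℕ → ℕ} (h : Computable f) : RT O f :=
  recIn_of_partrec O (Partrec.nat_iff.1 h)

theorem RT.of_prim {O : ℕ → ℕ} {f : ℕ → ℕ} (h : Primrec f) : RT O f := RT.of_comp h.to_comp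

theorem RT.comp {O : ℕ → ℕ} {f g : ℕ → ℕ} (hf : RT O f) (hg : RT O g) :
    RT O (fun n => f (g n)) := by
  have := RecIn.comp hf hg
  simpa [RT] using this

theorem RT.pair {O : ℕ → ℕ} {f g : ℕ → ℕ} (hf : RT O f) (hg : RT O g) :
    RT O (fun n => Nat.pair (f n) (g n)) := by
  have := RecIn.pair hf hg
  simpa [RT, Seq.seq] using this

/-- post-compose with a primitive recursive binary function -/
theorem RT.map₂ {O : ℕ → ℕ} {f g : ℕ → ℕ} {H : ℕ → ℕ → ℕ} (hH : Primrec₂ H)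
    (hf : RT O f) (hg : RT O g) : RT O (fun n => H (f n) (g n)) := by
  have h1 : Primrec (fun p : ℕ => H p.unpair.1 p.unpair.2) :=
    hH.comp (Primrec.fst.comp Primrec.unpair) (Primrec.snd.comp Primrec.unpair)
  simpa using RT.comp (RT.of_prim h1) (RT.pair hf hg)

theorem RT.rfind {O : ℕ → ℕ} {f : ℕ → ℕ} {g : ℕ → ℕ} (hf : RT O f)
    (hg : ∀ a, f (Nat.pair a (g a)) = 0 ∧ ∀ m < g a, f (Nat.pair a m) ≠ 0) : RT O g := by
  have := RecIn.rfind hf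
  refine RecIn.of_eq this fun a => ?_
  symm
  rw [Part.eq_some_iff]
  refine Nat.mem_rfind.2 ?_
  obtain ⟨h1, h2⟩ := hg a
  constructor
  · simp [h1]
  · intro m hm
    simp [h2 m hm]

/-- initial segment of a function as a list -/
def pre (u : ℕ → ℕ) (k : ℕ) : List ℕ := (List.range k).map u

theorem pre_succ (u : ℕ → ℕ) (k : ℕ) : pre u (k+1) = pre u k ++ [u k] := by
  simp [pre, List.range_succ]

@[simp] theorem pre_length (u : ℕ → ℕ) (k : ℕ) : (pre u k).length = k := by simp [pre]

theorem pre_get (u : ℕ → ℕ) {k n : ℕ} (h : n < k) : (pre u k)[n]? = some (u n) := by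
  simp [pre, h]

theorem pre_take (u : ℕ → ℕ) {k n : ℕ} (h : n ≤ k) : (pre u k).take n = pre u n := by
  simp [pre, ← List.map_take, List.take_range, h]

open Encodable Denumerable in
theorem RT.pre {O u : ℕ → ℕ} (hu : RT O u) : RT O (fun k => encode (pre u k)) := by
  have hH : Primrec₂ (fun i v : ℕ => encode (ofNat (List ℕ) i ++ [v])) :=
    Primrec.encode.comp (Primrec.list_append.comp ((Primrec.ofNat _).comp Primrec.fst)
      (Primrec.list_cons.comp Primrec.snd (Primrec.const [])))
  have hu' : RT O (fun p : ℕ => u (p.unpair.2.unpair.1)) :=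
    RT.comp hu (RT.of_prim (Primrec.fst.comp (Primrec.unpair.comp (Primrec.snd.comp Primrec.unpair))))
  have hi : RT O (fun p : ℕ => p.unpair.2.unpair.2) :=
    RT.of_prim (Primrec.snd.comp (Primrec.unpair.comp (Primrec.snd.comp Primrec.unpair)))
  have hstep := RT.map₂ hH hi hu'
  have hz : RT O (fun _ => encode ([] : List ℕ)) := RT.of_prim (Primrec.const _)
  have hp := RecIn.prec hz hstep
  have key : RT O (fun p : ℕ => encode (_root_.pre u p.unpair.2)) := by
    refine RecIn.of_eq hp fun p => ?_
    simp only [Nat.unpaired]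
    generalize p.unpair.2 = k
    induction k with
    | zero => simp [_root_.pre]
    | succ k ih =>
      simp only [← ih]
      simp [pre_succ]
  have := RT.comp key (RT.of_prim (Primrec₂.natPair.comp (Primrec.const 0) Primrec.id))
  simpa using this

/-- eventual computability from initial segments -/
def Approx (O : ℕ → ℕ) (f : ℕ →. ℕ) (F : List ℕ → ℕ →. ℕ) : Prop :=
  Partrec₂ F ∧ (∀ k n y, y ∈ F (pre O k) n → y ∈ f n) ∧
    (∀ n y, y ∈ f n → ∃ k0, ∀ k ≥ k0, y ∈ F (pre O k) n)

theorem approx_of_comp {O : ℕ → ℕ} {f : ℕ → ℕ} (h : Computable f) :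
    Approx O (fun n => Part.some (f n)) (fun _ n => Part.some (f n)) :=
  ⟨(h.comp Computable.snd).partrec, fun _ _ _ h => h, fun _ _ h => ⟨0, fun _ _ => h⟩⟩

theorem use_principle {O : ℕ → ℕ} {f : ℕ →. ℕ} (h : RecIn O f) : ∃ F, Approx O f F := by
  induction h with
  | oracle =>
    refine ⟨fun l n => (l[n]? : Part ℕ), ?_, ?_, ?_⟩
    · exact (Computable.list_getElem?.comp Computable.fst Computable.snd).ofOption
    · intro k n y hy
      simp only [Part.mem_coe] at hy
      by_cases hn : n < k
      · rw [pre_get O hn] at hy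
        simpa using hy.symm
      · simp [hn] at hy
    · intro n y hy
      refine ⟨n+1, fun k hk => ?_⟩
      show y ∈ (((pre O k)[n]? : Option ℕ) : Part ℕ)
      rw [pre_get O (show n < k by omega)]
      simpa using hy
  | zero => exact ⟨_, approx_of_comp (Computable.const 0)⟩
  | succ => exact ⟨_, approx_of_comp Computable.succ⟩
  | left => exact ⟨_, approx_of_comp (Computable.fst.comp Computable.unpair)⟩
  | right => exact ⟨_, approx_of_comp (Computable.snd.comp Computable.unpair)⟩
  | @pair f g _ _ h1 h2 =>
    obtain ⟨F, F1, F2, F3⟩ := h1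
    obtain ⟨G, G1, G2, G3⟩ := h2
    refine ⟨fun l n => (F l n).bind fun a => (G l n).map fun b => Nat.pair a b, ?_, ?_, ?_⟩
    · have hG : Partrec (fun p : (List ℕ × ℕ) × ℕ => G p.1.1 p.1.2) :=
        G1.comp (Computable.fst.comp Computable.fst) (Computable.snd.comp Computable.fst)
      have hM : Partrec₂ (fun (p : List ℕ × ℕ) (a : ℕ) => (G p.1 p.2).map fun b => Nat.pair a b) :=
        Partrec.map hG (g := fun (p : (List ℕ × ℕ) × ℕ) b => Nat.pair p.2 b)
          (Primrec₂.natPair.comp (Primrec.snd.comp Primrec.fst) Primrec.snd).to_comp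
      exact Partrec.bind F1 hM
    · intro k n y hy
      simp only [Part.mem_bind_iff, Part.mem_map_iff] at hy
      obtain ⟨a, ha, b, hb, rfl⟩ := hy
      simp only [Seq.seq, Part.map_eq_map, Part.mem_bind_iff, Part.mem_map_iff]
      exact ⟨_, ⟨a, F2 _ _ _ ha, rfl⟩, b, G2 _ _ _ hb, rfl⟩
    · intro n y hy
      simp only [Seq.seq, Part.map_eq_map, Part.mem_bind_iff,
        Part.mem_map_iff] at hy
      obtain ⟨_, ⟨a, ha, rfl⟩, b, hb, rfl⟩ := hy
      obtain ⟨k1, h1⟩ := F3 _ _ ha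
      obtain ⟨k2, h2⟩ := G3 _ _ hb
      refine ⟨max k1 k2, fun k hk => ?_⟩
      simp only [Part.mem_bind_iff, Part.mem_map_iff]
      exact ⟨a, h1 k (by omega), b, h2 k (by omega), rfl⟩
  | @comp f g _ _ h1 h2 =>
    obtain ⟨F, F1, F2, F3⟩ := h1
    obtain ⟨G, G1, G2, G3⟩ := h2
    refine ⟨fun l n => (G l n).bind fun a => F l a, ?_, ?_, ?_⟩
    · exact Partrec.bind G1 (F1.comp (Computable.fst.comp Computable.fst) Computable.snd)
    · intro k n y hy
      simp only [Part.mem_bind_iff] at hy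
      obtain ⟨a, ha, hy⟩ := hy
      exact Part.mem_bind_iff.2 ⟨a, G2 _ _ _ ha, F2 _ _ _ hy⟩
    · intro n y hy
      obtain ⟨a, ha, hy⟩ := Part.mem_bind_iff.1 hy
      obtain ⟨k1, h1⟩ := F3 _ _ hy
      obtain ⟨k2, h2⟩ := G3 _ _ ha
      refine ⟨max k1 k2, fun k hk => ?_⟩
      exact Part.mem_bind_iff.2 ⟨a, h2 k (by omega), h1 k (by omega)⟩
  | @prec f g _ _ h1 h2 =>
    obtain ⟨F, F1, F2, F3⟩ := h1
    obtain ⟨G, G1, G2, G3⟩ := h2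
    refine ⟨fun l p => Nat.rec (F l p.unpair.1) (fun y IH => IH.bind fun i =>
      G l (Nat.pair p.unpair.1 (Nat.pair y i))) p.unpair.2, ?_, ?_, ?_⟩
    · have hu1 : Computable fun p : List ℕ × ℕ => p.2.unpair.1 :=
        Computable.fst.comp (Computable.unpair.comp Computable.snd)
      have hu2 : Computable fun p : List ℕ × ℕ => p.2.unpair.2 :=
        Computable.snd.comp (Computable.unpair.comp Computable.snd)
      refine Partrec.nat_rec (h := fun p q => G p.1 (Nat.pair p.2.unpair.1 (Nat.pair q.1 q.2)))
        hu2 (F1.comp Computable.fst hu1) ?_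
      refine G1.comp (Computable.fst.comp Computable.fst) ?_
      exact Primrec₂.natPair.to_comp.comp (hu1.comp Computable.fst)
        (Primrec₂.natPair.to_comp.comp (Computable.fst.comp Computable.snd)
          (Computable.snd.comp Computable.snd))
    · intro k n y hy
      simp only [Nat.unpaired] at hy ⊢
      generalize n.unpair.1 = a at *
      generalize n.unpair.2 = m at *
      induction m generalizing y with
      | zero => exact F2 _ _ _ hy
      | succ m ih =>
        obtain ⟨i, hi, hy⟩ := Part.mem_bind_iff.1 hy
        exact Part.mem_bind_iff.2 ⟨i, ih _ hi, G2 _ _ _ hy⟩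
    · intro n y hy
      simp only [Nat.unpaired] at hy ⊢
      generalize n.unpair.1 = a at *
      generalize n.unpair.2 = m at *
      induction m generalizing y with
      | zero => exact F3 _ _ hy
      | succ m ih =>
        obtain ⟨i, hi, hy⟩ := Part.mem_bind_iff.1 hy
        obtain ⟨k1, h1⟩ := ih _ hi
        obtain ⟨k2, h2⟩ := G3 _ _ hy
        exact ⟨max k1 k2, fun k hk => Part.mem_bind_iff.2 ⟨i, h1 k (by omega), h2 k (by omega)⟩⟩
  | @rfind f _ h1 =>
    obtain ⟨F, F1, F2, F3⟩ := h1
    refine ⟨fun l a => Nat.rfind fun n => (F l (Nat.pair a n)).map fun m => decide (m = 0),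
      ?_, ?_, ?_⟩
    · refine Partrec.rfind (p := fun (q : List ℕ × ℕ) n =>
        (F q.1 (Nat.pair q.2 n)).map fun m => decide (m = 0)) ?_
      refine Partrec.map (F1.comp (Computable.fst.comp Computable.fst)
        (Primrec₂.natPair.to_comp.comp (Computable.snd.comp Computable.fst) Computable.snd)) ?_
      exact (Primrec.eq.decide.comp Primrec.snd (Primrec.const 0)).to_comp
    · intro k n y hy
      replace hy := Nat.mem_rfind.1 hy
      refine Nat.mem_rfind.2 ?_
      refine ⟨?_, fun {m} hm => ?_⟩
      · obtain ⟨v, hv, e⟩ := (Part.mem_map_iff _).1 hy.1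
        exact (Part.mem_map_iff _).2 ⟨v, F2 _ _ _ hv, e⟩
      · obtain ⟨v, hv, e⟩ := (Part.mem_map_iff _).1 (hy.2 hm)
        exact (Part.mem_map_iff _).2 ⟨v, F2 _ _ _ hv, e⟩
    · intro n y hy
      replace hy := Nat.mem_rfind.1 hy
      have key : ∀ m ≤ y, ∃ k0, ∀ k ≥ k0, (decide (m = y)) ∈
          (F (pre O k) (Nat.pair n m)).map fun m => decide (m = 0) := by
        intro m hm
        have : decide (m = y) ∈ (fun m => decide (m = 0)) <$> f (Nat.pair n m) := by
          rcases hm.lt_or_eq with h | h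
          · simpa [h.ne] using hy.2 h
          · subst h; simpa using hy.1
        obtain ⟨v, hv, e⟩ := (Part.mem_map_iff _).1 this
        obtain ⟨k0, h0⟩ := F3 _ _ hv
        exact ⟨k0, fun k hk => (Part.mem_map_iff _).2 ⟨v, h0 k hk, e⟩⟩
      choose! c hc using key
      refine ⟨(Finset.range (y+1)).sup c, fun k hk => ?_⟩
      have hk' : ∀ m ≤ y, c m ≤ k := fun m hm =>
        le_trans (Finset.le_sup (f := c) (by simp; omega)) hk
      refine Nat.mem_rfind.2 ?_
      refine ⟨?_, fun {m} hm => ?_⟩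
      · simpa using hc y le_rfl k (hk' y le_rfl)
      · simpa [hm.ne] using hc m hm.le k (hk' m hm.le)

open Nat.Partrec (Code)

/-- translate oracle codes (with zero oracle) into plain codes -/
def trC : OCode → Code
  | .zero => .zero
  | .succ => .succ
  | .left => .left
  | .right => .right
  | .oracle => .zero
  | .pair a b => .pair (trC a) (trC b)
  | .comp a b => .comp (trC a) (trC b)
  | .prec a b => .prec (trC a) (trC b)
  | .rfind' a => .rfind' (trC a)

theorem chi_empty (n : ℕ) : chi ∅ n = 0 := by simp [chi]

theorem eval_trC (c : OCode) : Code.eval (trC c) = evalo (chi ∅) c := by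
  induction c with
  | zero => rfl
  | succ => rfl
  | left => rfl
  | right => rfl
  | oracle => funext n; simp [evalo, trC, chi_empty, Code.eval]; rfl
  | pair a b h1 h2 => simp only [trC, Code.eval, evalo, h1, h2]; rfl
  | comp a b h1 h2 => simp only [trC, Code.eval, evalo, h1, h2]; rfl
  | prec a b h1 h2 => simp only [trC, Code.eval, evalo, h1, h2]; rfl
  | rfind' a h1 => simp only [trC, Code.eval, evalo, h1]; rfl

def trN (n : ℕ) : Code := trC (ofNatOCode n)

def trG₁ (p : List Code × ℕ × ℕ) : Option Code :=
  letI IH := p.1; letI n := p.2.1; letI m := p.2.2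
  IH[m]?.bind fun s =>
  IH[m.unpair.1]?.bind fun s₁ =>
  IH[m.unpair.2]?.map fun s₂ =>
  cond n.bodd (cond n.div2.bodd (Code.rfind' s) (Code.prec s₁ s₂))
    (cond n.div2.bodd (Code.comp s₁ s₂) (Code.pair s₁ s₂))

theorem trG₁_prim : Primrec trG₁ := by
  open Primrec in
  exact
    option_bind (list_getElem?.comp fst (snd.comp snd)) <| .mk <|
    option_bind ((list_getElem?.comp fst
      (fst.comp <| Primrec.unpair.comp (snd.comp snd))).comp fst) <| .mk <|
    option_map ((list_getElem?.comp fst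
      (snd.comp <| Primrec.unpair.comp (snd.comp snd))).comp <| fst.comp fst) <| .mk <|
    have n := fst.comp (snd.comp <| fst.comp <| fst.comp fst)
    have s := snd.comp (fst.comp fst)
    have s₁ := snd.comp fst
    have s₂ := snd
    (nat_bodd.comp n).cond
      ((nat_bodd.comp <| nat_div2.comp n).cond
        (Code.primrec_rfind'.comp s)
        (Code.primrec₂_prec.comp s₁ s₂))
      (Primrec.cond (nat_bodd.comp <| nat_div2.comp n)
        (Code.primrec₂_comp.comp s₁ s₂)
        (Code.primrec₂_pair.comp s₁ s₂))

theorem trG₁_eq (n : ℕ) : trG₁ ((List.range (n+5)).map trN, n, n.div2.div2) = some (trN (n+5)) := by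
  have hm : n.div2.div2 < n + 5 := by
    rw [Nat.div2_val, Nat.div2_val]; omega
  have m1 : n.div2.div2.unpair.1 < n + 5 := lt_of_le_of_lt (Nat.unpair_left_le _) hm
  have m2 : n.div2.div2.unpair.2 < n + 5 := lt_of_le_of_lt (Nat.unpair_right_le _) hm
  have h : trN (n+5) = cond n.bodd (cond n.div2.bodd (Code.rfind' (trN n.div2.div2))
        (Code.prec (trN n.div2.div2.unpair.1) (trN n.div2.div2.unpair.2)))
      (cond n.div2.bodd (Code.comp (trN n.div2.div2.unpair.1) (trN n.div2.div2.unpair.2))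
        (Code.pair (trN n.div2.div2.unpair.1) (trN n.div2.div2.unpair.2))) := by
    rw [trN, ofNatOCode]
    cases n.bodd <;> cases n.div2.bodd <;> simp [trC, trN]
  rw [h]
  simp [trG₁, hm, m1, m2]

theorem trN_prim : Primrec trN := by
  let G : List Code → Option Code := fun IH =>
    IH.length.casesOn (some .zero) fun n =>
    n.casesOn (some .succ) fun n =>
    n.casesOn (some .left) fun n =>
    n.casesOn (some .right) fun n =>
    n.casesOn (some .zero) fun n =>
    trG₁ (IH, n, n.div2.div2)
  have hG : Primrec G := by
    open Primrec in
    exact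
      nat_casesOn list_length (const _) <| .mk <|
      nat_casesOn snd (const _) <| .mk <|
      nat_casesOn snd (const _) <| .mk <|
      nat_casesOn snd (const _) <| .mk <|
      nat_casesOn snd (const _) <| .mk <|
      trG₁_prim.comp <|
        (fst.comp <| fst.comp <| fst.comp <| fst.comp fst).pair <|
        snd.pair <| nat_div2.comp <| nat_div2.comp snd
  have := Primrec.nat_strong_rec (fun (_ : Unit) n => trN n) (g := fun _ l => G l)
    (hG.comp Primrec.snd) (fun a n => by
      iterate 5 rcases n with - | n; · simp [G, trN, ofNatOCode, trC] <;> rfl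
      have := trG₁_eq n
      simp only [G]; rw [List.length_map, List.length_range]
      exact this)
  exact this.comp (Primrec.const ()) Primrec.id

/-- stage approximation to `K` -/
def Kst (e s : ℕ) : Bool := (Code.evaln s (trN e) e).isSome

theorem Kst_prim : Primrec₂ Kst := by
  have h : Primrec (fun p : ℕ × ℕ => Code.evaln p.2 (trN p.1) p.1) :=
    Code.primrec_evaln.comp ((Primrec.snd.pair (trN_prim.comp Primrec.fst)).pair Primrec.fst)
  exact Primrec.option_isSome.comp h

theorem Kst_mono {e s t : ℕ} (h : s ≤ t) (hs : Kst e s = true) : Kst e t = true := by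
  unfold Kst at *
  obtain ⟨x, hx⟩ := Option.isSome_iff_exists.1 hs
  exact Option.isSome_iff_exists.2 ⟨x, Code.evaln_mono h hx⟩

theorem mem_K (e : ℕ) : e ∈ K ↔ ∃ s, Kst e s = true := by
  have : e ∈ K ↔ (Code.eval (trN e) e).Dom := by
    rw [trN, eval_trC]; rfl
  rw [this, Part.dom_iff_mem]
  simp only [Code.evaln_complete, Kst, Option.isSome_iff_exists]
  exact exists_comm

theorem exists_uK (e : ℕ) : ∃ s, chi K e = 0 ∨ Kst e s = true := by
  by_cases h : e ∈ K
  · obtain ⟨s, hs⟩ := (mem_K e).1 h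
    exact ⟨s, Or.inr hs⟩
  · exact ⟨0, Or.inl (by simp [chi, h])⟩

noncomputable def uK (e : ℕ) : ℕ := Nat.find (exists_uK e)

theorem uK_spec {e : ℕ} (h : e ∈ K) : Kst e (uK e) = true := by
  have := Nat.find_spec (exists_uK e)
  rcases this with h1 | h1
  · simp [chi, h] at h1
  · exact h1

theorem uK_rt : RT (chi K) uK := by
  have h1 : RT (chi K) (fun p => chi K p.unpair.1) :=
    RT.comp (f := chi K) RecIn.oracle (RT.of_prim (Primrec.fst.comp Primrec.unpair))
  have hH : Primrec₂ (fun c p : ℕ => if c = 0 ∨ Kst p.unpair.1 p.unpair.2 = true then 0 else 1) := by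
    refine Primrec.ite (PrimrecPred.or ?_ ?_) (Primrec.const 0) (Primrec.const 1)
    · exact Primrec.eq.comp Primrec.fst (Primrec.const 0)
    · exact Primrec.eq.comp (Kst_prim.comp (Primrec.fst.comp (Primrec.unpair.comp Primrec.snd))
        (Primrec.snd.comp (Primrec.unpair.comp Primrec.snd))) (Primrec.const true)
  refine RT.rfind (RT.map₂ hH h1 (RT.of_prim Primrec.id)) fun a => ⟨?_, fun m hm => ?_⟩
  · have := Nat.find_spec (exists_uK a)
    rw [if_pos]
    simpa [uK] using this
  · have := Nat.find_min (exists_uK a) hm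
    rw [if_neg]
    · simp
    · simpa using this

noncomputable def mK (n : ℕ) : ℕ := (pre uK n).sum

theorem mK_succ (n : ℕ) : mK (n+1) = mK n + uK n := by simp [mK, pre_succ]

theorem mK_mono : Monotone mK := monotone_nat_of_le_succ fun n => by rw [mK_succ]; omega

theorem list_sum_prim : Primrec (fun l : List ℕ => l.sum) := by
  have : Primrec (fun l : List ℕ => l.foldr (fun a b => a + b) 0) :=
    Primrec.list_foldr Primrec.id (Primrec.const 0)
      (h := fun _ p => p.1 + p.2)
      (Primrec.nat_add.comp (Primrec.fst.comp Primrec.snd) (Primrec.snd.comp Primrec.snd))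
  exact this.of_eq fun l => by simp [List.sum]

theorem mK_rt : RT (chi K) mK := by
  have h := RT.pre uK_rt
  have h2 : Primrec (fun n : ℕ => (Denumerable.ofNat (List ℕ) n).sum) :=
    list_sum_prim.comp (Primrec.ofNat _)
  have := RT.comp (RT.of_prim h2) h
  refine RecIn.of_eq this fun n => ?_
  simp [mK]

/-- no function recursive in an oracle not computing `K` dominates `mK` -/
theorem not_dominated {D : Set ℕ} (hD : ¬ TRed K D) {g : ℕ → ℕ} (hg : RT (chi D) g) (n0 : ℕ) :
    ∃ n ≥ n0, g n < mK n := by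
  by_contra! hc
  apply hD
  have h1 : RT (chi D) (fun e => g (max (e+1) n0)) :=
    RT.comp hg (RT.of_prim (Primrec.nat_max.comp Primrec.succ (Primrec.const n0)))
  have hH : Primrec₂ (fun e s : ℕ => if Kst e s = true then 1 else 0) :=
    Primrec.ite (Primrec.eq.comp Kst_prim (Primrec.const true)) (Primrec.const 1) (Primrec.const 0)
  have := RT.map₂ hH (RT.of_prim Primrec.id) h1
  refine RecIn.of_eq this fun e => ?_
  congr 1
  unfold chi
  have : e ∈ K ↔ Kst (id e) (g (max (e+1) n0)) = true := by
    constructor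
    · intro h
      refine Kst_mono ?_ (uK_spec h)
      calc uK e ≤ mK (e+1) := by rw [mK_succ]; omega
        _ ≤ mK (max (e+1) n0) := mK_mono (le_max_left _ _)
        _ ≤ _ := hc _ (le_max_right _ _)
    · intro h
      exact (mem_K e).2 ⟨_, h⟩
  simp only [this]

open Encodable Denumerable in
/-- bounded test whether machine `e` accepts `x` using oracle prefix `l` -/
def btest (l : List ℕ) (e x : ℕ) : Prop :=
  ∃ j ∈ List.range (l.length + 1),
    Code.evaln l.length (ofNat Code e) (Nat.pair (encode (l.take j)) x) = some 1

open Primrec in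
theorem btest_prim : PrimrecPred (fun p : List ℕ × ℕ × ℕ => btest p.1 p.2.1 p.2.2) := by
  have hR : PrimrecRel (fun (j : ℕ) (p : List ℕ × ℕ × ℕ) =>
      Code.evaln p.1.length (Denumerable.ofNat Code p.2.1)
        (Nat.pair (Encodable.encode (p.1.take j)) p.2.2) = some 1) := by
    refine Primrec.eq.comp ?_ (Primrec.const (some 1))
    have hl : Primrec (fun q : ℕ × (List ℕ × ℕ × ℕ) => q.2.1) := fst.comp snd
    have he : Primrec (fun q : ℕ × (List ℕ × ℕ × ℕ) => q.2.2.1) := fst.comp (snd.comp snd)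
    have hx : Primrec (fun q : ℕ × (List ℕ × ℕ × ℕ) => q.2.2.2) := snd.comp (snd.comp snd)
    have h1 : Primrec (fun q : ℕ × (List ℕ × ℕ × ℕ) =>
        Nat.pair (Encodable.encode (q.2.1.take q.1)) q.2.2.2) :=
      Primrec₂.natPair.comp (Primrec.encode.comp (list_take.comp fst hl)) hx
    exact Code.primrec_evaln.comp
      (((list_length.comp hl).pair ((Primrec.ofNat Code).comp he)).pair h1)
  exact hR.exists_mem_list.comp
    (list_range.comp (succ.comp (list_length.comp fst))) Primrec.id

open Encodable Denumerable in
theorem btest_pre (u : ℕ → ℕ) (k e x : ℕ) : btest (pre u k) e x ↔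
    ∃ j ≤ k, Code.evaln k (ofNat Code e) (Nat.pair (encode (pre u j)) x) = some 1 := by
  unfold btest
  simp only [pre_length, List.mem_range, Nat.lt_succ_iff]
  refine exists_congr fun j => and_congr_right fun hj => ?_
  rw [pre_take u hj]

theorem btest_mono {u : ℕ → ℕ} {k k' e x : ℕ} (h : k ≤ k') (hb : btest (pre u k) e x) :
    btest (pre u k') e x := by
  rw [btest_pre] at *
  obtain ⟨j, hj, hv⟩ := hb
  exact ⟨j, hj.trans h, Code.evaln_mono h hv⟩

/-- the bets -/
noncomputable def bet (D : Set ℕ) (p : ℕ) : ℕ :=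
  if p.unpair.1 < p.unpair.2 ∧ btest (pre (chi D) (mK p.unpair.2)) p.unpair.1 p.unpair.2
    then 1 else 0

theorem bet_rt {D : Set ℕ} (hD : TRed D K) : RT (chi K) (bet D) := by
  have h1 : RT (chi K) (fun p => Encodable.encode (pre (chi D) (mK p.unpair.2))) :=
    RT.comp (RT.pre (show RT (chi K) (chi D) from hD))
      (RT.comp mK_rt (RT.of_prim (Primrec.snd.comp Primrec.unpair)))
  have hH : Primrec₂ (fun l p : ℕ => if p.unpair.1 < p.unpair.2 ∧
      btest (Denumerable.ofNat (List ℕ) l) p.unpair.1 p.unpair.2 then 1 else 0) := by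
    have hu1 : Primrec (fun q : ℕ × ℕ => q.2.unpair.1) :=
      Primrec.fst.comp (Primrec.unpair.comp Primrec.snd)
    have hu2 : Primrec (fun q : ℕ × ℕ => q.2.unpair.2) :=
      Primrec.snd.comp (Primrec.unpair.comp Primrec.snd)
    refine Primrec.ite (PrimrecPred.and ?_ ?_) (Primrec.const 1) (Primrec.const 0)
    · exact Primrec.nat_lt.comp hu1 hu2
    · exact btest_prim.comp (((Primrec.ofNat (List ℕ)).comp Primrec.fst).pair (hu1.pair hu2))
  refine RecIn.of_eq (RT.map₂ hH h1 (RT.of_prim Primrec.id)) fun p => ?_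
  simp [bet]

theorem bet_lt {D : Set ℕ} {e x : ℕ} (h : bet D (Nat.pair e x) = 1) : e < x := by
  by_contra hc
  simp [bet, hc] at h

open Encodable Denumerable in
theorem bet_complete {D S : Set ℕ} (hD : ¬ TRed K D) (hS : TRed S D) (hi : S.Infinite) :
    ∃ e, (∀ x, bet D (Nat.pair e x) = 1 → x ∈ S) ∧ ∀ n0, ∃ x ≥ n0, bet D (Nat.pair e x) = 1 := by
  obtain ⟨F, F1, F2, F3⟩ := use_principle hS
  have hP : Nat.Partrec (fun p => F (ofNat (List ℕ) p.unpair.1) p.unpair.2) :=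
    Partrec.nat_iff.1 (F1.comp ((Computable.ofNat _).comp (Computable.fst.comp Computable.unpair))
      (Computable.snd.comp Computable.unpair))
  obtain ⟨c, hc⟩ := Code.exists_code.1 hP
  have hsound : ∀ k x, btest (pre (chi D) k) (encode c) x → x ∈ S := by
    intro k x h
    obtain ⟨j, _, hj⟩ := (btest_pre _ _ _ _).1 h
    have := Code.evaln_sound hj
    rw [ofNat_encode, hc] at this
    simp only [Nat.unpair_pair, ofNat_encode] at this
    have := F2 _ _ _ this
    by_contra hx
    simp [chi, hx] at this
  have hcompl : ∀ x ∈ S, ∃ k, btest (pre (chi D) k) (encode c) x := by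
    intro x hx
    obtain ⟨k0, h0⟩ := F3 x 1 (by simp [chi, hx])
    have h1 := h0 k0 le_rfl
    have : (1 : ℕ) ∈ Code.eval c (Nat.pair (encode (pre (chi D) k0)) x) := by
      rw [hc]; simpa using h1
    obtain ⟨k, hk⟩ := Code.evaln_complete.1 this
    refine ⟨max k0 k, (btest_pre _ _ _ _).2 ⟨k0, le_max_left _ _, ?_⟩⟩
    rw [ofNat_encode]
    exact Code.evaln_mono (le_max_right _ _) hk
  have hex : ∀ n, ∃ t : ℕ, n ≤ t.unpair.1 ∧
      btest (pre (chi D) t.unpair.2) (encode c) t.unpair.1 := by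
    intro n
    obtain ⟨x, hx, hn⟩ := hi.exists_gt n
    obtain ⟨k, hk⟩ := hcompl x hx
    exact ⟨Nat.pair x k, by simpa using ⟨hn.le, hk⟩⟩
  have hg : RT (chi D) (fun n => Nat.find (hex n)) := by
    have h1 : RT (chi D) (fun p => encode (pre (chi D) p.unpair.2.unpair.2)) :=
      RT.comp (RT.pre (show RT (chi D) (chi D) from RecIn.oracle))
        (RT.of_prim (Primrec.snd.comp (Primrec.unpair.comp (Primrec.snd.comp Primrec.unpair))))
    have hH : Primrec₂ (fun l p : ℕ => if p.unpair.1 ≤ p.unpair.2.unpair.1 ∧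
        btest (ofNat (List ℕ) l) (encode c) p.unpair.2.unpair.1 then 0 else 1) := by
      have hu1 : Primrec (fun q : ℕ × ℕ => q.2.unpair.1) :=
        Primrec.fst.comp (Primrec.unpair.comp Primrec.snd)
      have hu2 : Primrec (fun q : ℕ × ℕ => q.2.unpair.2.unpair.1) :=
        Primrec.fst.comp (Primrec.unpair.comp
          (Primrec.snd.comp (Primrec.unpair.comp Primrec.snd)))
      refine Primrec.ite (PrimrecPred.and ?_ ?_) (Primrec.const 0) (Primrec.const 1)
      · exact Primrec.nat_le.comp hu1 hu2
      · exact btest_prim.comp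
          (((Primrec.ofNat (List ℕ)).comp Primrec.fst).pair ((Primrec.const (encode c)).pair hu2))
    refine RT.rfind (RT.map₂ hH h1 (RT.of_prim Primrec.id)) fun a => ⟨?_, fun m hm => ?_⟩
    · have := Nat.find_spec (hex a)
      rw [if_pos]
      simpa using this
    · have := Nat.find_min (hex a) hm
      rw [if_neg]
      · simp
      · simpa using this
  refine ⟨encode c, fun x hx => ?_, fun n0 => ?_⟩
  · unfold bet at hx
    split_ifs at hx with h
    simp only [Nat.unpair_pair] at h
    exact hsound _ _ h.2
  · obtain ⟨n, hn, hlt⟩ := not_dominated hD hg (max n0 (encode c + 1))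
    obtain ⟨h1, h2⟩ := Nat.find_spec (hex n)
    set t := Nat.find (hex n) with ht
    refine ⟨t.unpair.1, by omega, ?_⟩
    unfold bet
    rw [if_pos]
    simp only [Nat.unpair_pair]
    refine ⟨by omega, btest_mono ?_ h2⟩
    calc t.unpair.2 ≤ t := Nat.unpair_right_le _
      _ ≤ mK n := hlt.le
      _ ≤ _ := mK_mono h1

/-- capital of a single strategy -/
def cap (b : ℕ → ℕ) (i : Bool) (e : ℕ) (σ : List Bool) (n : ℕ) : ℕ :=
  Nat.rec 1 (fun x c => c * (if b (Nat.pair e x) = 1 then (if σ[x]? = some i then 2 else 0) else 1)) n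

theorem cap_succ (b : ℕ → ℕ) (i : Bool) (e : ℕ) (σ : List Bool) (n : ℕ) :
    cap b i e σ (n+1) = cap b i e σ n *
      (if b (Nat.pair e n) = 1 then (if σ[n]? = some i then 2 else 0) else 1) := rfl

def capU (b : ℕ → ℕ) (σ : List Bool) (n : ℕ) : ℕ :=
  Nat.rec 0 (fun e c => 2 * c + (cap b true e σ σ.length + cap b false e σ σ.length)) n

theorem capU_succ (b : ℕ → ℕ) (σ : List Bool) (n : ℕ) :
    capU b σ (n+1) = 2 * capU b σ n + (cap b true n σ σ.length + cap b false n σ σ.length) := rfl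

def mart (b : ℕ → ℕ) (σ : List Bool) : ℚ := ((capU b σ σ.length + 2 : ℕ) : ℚ) / ((2 ^ σ.length : ℕ) : ℚ)

theorem cap_append (b : ℕ → ℕ) (i j : Bool) (e : ℕ) (σ : List Bool) (n : ℕ) (h : n ≤ σ.length) :
    cap b i e (σ ++ [j]) n = cap b i e σ n := by
  induction n with
  | zero => rfl
  | succ n ih =>
    rw [cap_succ, cap_succ, ih (by omega), List.getElem?_append_left (by omega)]

theorem cap_split (b : ℕ → ℕ) (i : Bool) (e : ℕ) (σ : List Bool) :
    cap b i e (σ ++ [false]) (σ.length + 1) + cap b i e (σ ++ [true]) (σ.length + 1)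
      = 2 * cap b i e σ σ.length := by
  rw [cap_succ, cap_succ, cap_append _ _ _ _ _ _ le_rfl, cap_append _ _ _ _ _ _ le_rfl]
  cases i <;> by_cases h : b (Nat.pair e σ.length) = 1 <;> simp [h] <;> ring

theorem capU_split (b : ℕ → ℕ) (σ : List Bool) (n : ℕ) :
    capU b (σ ++ [false]) n + capU b (σ ++ [true]) n = 2 * capU b σ n := by
  induction n with
  | zero => rfl
  | succ n ih =>
    simp only [capU_succ, List.length_append, List.length_singleton]
    have h1 := cap_split b true n σ
    have h2 := cap_split b false n σ
    omega

theorem cap_one {b : ℕ → ℕ} (hb : ∀ e x, b (Nat.pair e x) = 1 → e < x) (i : Bool) (e : ℕ)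
    (σ : List Bool) (n : ℕ) (h : n ≤ e + 1) : cap b i e σ n = 1 := by
  induction n with
  | zero => rfl
  | succ n ih =>
    rw [cap_succ, ih (by omega), if_neg]
    intro hh
    have := hb _ _ hh
    omega

theorem mart_isMartingale {b : ℕ → ℕ} (hb : ∀ e x, b (Nat.pair e x) = 1 → e < x) :
    IsMartingale (mart b) := by
  refine ⟨fun σ => by unfold mart; positivity, fun σ => ?_⟩
  unfold mart
  simp only [List.length_append, List.length_singleton, capU_succ]
  simp only [cap_one hb _ _ _ _ le_rfl]
  have h := capU_split b σ σ.length
  have h' : (capU b (σ ++ [false]) σ.length : ℚ) + capU b (σ ++ [true]) σ.length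
      = 2 * capU b σ σ.length := by exact_mod_cast h
  push_cast
  rw [pow_succ]
  field_simp
  linear_combination (-1) * h'

theorem capU_ge (b : ℕ → ℕ) (i : Bool) (σ : List Bool) (e m : ℕ) :
    2 ^ m * cap b i e σ σ.length ≤ capU b σ (e + 1 + m) := by
  induction m with
  | zero =>
    rw [Nat.add_zero, capU_succ]
    cases i <;> simp <;> omega
  | succ m ih =>
    rw [← Nat.add_assoc, capU_succ, pow_succ]
    nlinarith [Nat.zero_le (cap b true (e+1+m) σ σ.length)]

theorem seg_length (A : Set ℕ) (n : ℕ) : (seg A n).length = n := by simp [seg]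

theorem seg_get (A : Set ℕ) {n x : ℕ} (h : x < n) :
    (seg A n)[x]? = some (if x ∈ A then true else false) := by
  simp [seg, h]

theorem cap_seg_mono {b : ℕ → ℕ} {i : Bool} {e : ℕ} {A : Set ℕ}
    (h : ∀ x, b (Nat.pair e x) = 1 → (if x ∈ A then true else false) = i) (N : ℕ) {n : ℕ}
    (hn : n ≤ N) :
    cap b i e (seg A N) n = 2 ^ ((Finset.range n).filter fun x => b (Nat.pair e x) = 1).card := by
  induction n with
  | zero => rfl
  | succ n ih =>
    rw [cap_succ, ih (by omega), seg_get A (by omega), Finset.range_add_one, Finset.filter_insert]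
    by_cases hb : b (Nat.pair e n) = 1
    · rw [if_pos hb, if_pos hb, if_pos (by rw [h n hb]), Finset.card_insert_of_notMem (by simp),
        pow_succ]
    · rw [if_neg hb, if_neg hb, mul_one]

theorem mart_succeeds {b : ℕ → ℕ} {i : Bool} {e : ℕ} {A : Set ℕ}
    (h : ∀ x, b (Nat.pair e x) = 1 → (if x ∈ A then true else false) = i)
    (hinf : ∀ n0, ∃ x ≥ n0, b (Nat.pair e x) = 1) : Succeeds (mart b) A := by
  have hI : {x | b (Nat.pair e x) = 1}.Infinite := by
    rw [Set.infinite_iff_exists_gt]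
    intro a
    obtain ⟨x, hx, hb⟩ := hinf (a+1)
    exact ⟨x, hb, by omega⟩
  intro q
  obtain ⟨k, hk⟩ := exists_nat_gt (q * 2 ^ (e+1))
  obtain ⟨t, ht, htc⟩ := hI.exists_subset_card_eq k
  obtain ⟨B, hB⟩ := t.bddAbove
  set n := e + 1 + B with hn
  refine ⟨n + 1, ?_⟩
  have h1 : k ≤ ((Finset.range (n+1)).filter fun x => b (Nat.pair e x) = 1).card := by
    rw [← htc]
    refine Finset.card_le_card fun x hx => ?_
    have h2 : x ≤ B := hB hx
    have h3 := ht hx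
    simp only [Finset.mem_filter, Finset.mem_range]
    exact ⟨by omega, h3⟩
  have h2 : k < cap b i e (seg A (n+1)) (n+1) := by
    rw [cap_seg_mono h (n+1) le_rfl]
    exact lt_of_le_of_lt h1 Nat.lt_two_pow_self
  have h3 := capU_ge b i (seg A (n+1)) e (B+1)
  unfold mart
  rw [seg_length] at *
  rw [lt_div_iff₀ (by positivity)]
  have e1 : e + 1 + (B + 1) = n + 1 := by omega
  rw [e1] at h3
  have h4 : (2 : ℚ) ^ (B+1) * k ≤ (capU b (seg A (n+1)) (n+1) + 2 : ℕ) := by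
    have : 2 ^ (B+1) * k ≤ capU b (seg A (n+1)) (n+1) + 2 := by
      have := Nat.mul_le_mul_left (2 ^ (B+1)) h2.le
      omega
    exact_mod_cast this
  refine lt_of_lt_of_le ?_ h4
  push_cast
  rw [← e1, pow_add]
  have : (0 : ℚ) < 2 ^ (B+1) := by positivity
  nlinarith

/-- list lookup as a function -/
def lk (l : List ℕ) (p : ℕ) : ℕ := (l[p]?).getD 0

theorem lk_prim : Primrec₂ lk :=
  Primrec.option_getD.comp (Primrec.list_getElem?.comp Primrec.fst Primrec.snd) (Primrec.const 0)

open Primrec in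
theorem cap_prim (i : Bool) : Primrec (fun p : (List ℕ × List Bool) × ℕ =>
    cap (lk p.1.1) i p.2 p.1.2 p.1.2.length) := by
  refine Primrec.nat_rec' (f := fun p : (List ℕ × List Bool) × ℕ => p.1.2.length)
    (g := fun _ => 1) (h := fun p q => q.2 * (if lk p.1.1 (Nat.pair p.2 q.1) = 1 then
      (if p.1.2[q.1]? = some i then 2 else 0) else 1)) ?_ (Primrec.const 1) ?_
  · exact list_length.comp (snd.comp fst)
  · have hx : Primrec (fun z : ((List ℕ × List Bool) × ℕ) × (ℕ × ℕ) => z.2.1) := fst.comp snd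
    have hl : Primrec (fun z : ((List ℕ × List Bool) × ℕ) × (ℕ × ℕ) => z.1.1.1) :=
      fst.comp (fst.comp fst)
    have hs : Primrec (fun z : ((List ℕ × List Bool) × ℕ) × (ℕ × ℕ) => z.1.1.2) :=
      snd.comp (fst.comp fst)
    have he : Primrec (fun z : ((List ℕ × List Bool) × ℕ) × (ℕ × ℕ) => z.1.2) := snd.comp fst
    have hin : Primrec (fun z : ((List ℕ × List Bool) × ℕ) × (ℕ × ℕ) =>
        if z.1.1.2[z.2.1]? = some i then 2 else 0) :=
      Primrec.ite (Primrec.eq.comp (list_getElem?.comp hs hx) (Primrec.const (some i)))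
        (Primrec.const 2) (Primrec.const 0)
    exact nat_mul.comp (snd.comp snd) (Primrec.ite
      (Primrec.eq.comp (lk_prim.comp hl (Primrec₂.natPair.comp he hx)) (Primrec.const 1))
      hin (Primrec.const 1))

open Primrec in
theorem capU_prim : Primrec (fun p : List ℕ × List Bool => capU (lk p.1) p.2 p.2.length) := by
  refine Primrec.nat_rec' (f := fun p : List ℕ × List Bool => p.2.length)
    (g := fun _ => 0) (h := fun p q => 2 * q.2 + (cap (lk p.1) true q.1 p.2 p.2.length +
      cap (lk p.1) false q.1 p.2 p.2.length)) ?_ (Primrec.const 0) ?_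
  · exact list_length.comp snd
  · have ha : Primrec (fun z : (List ℕ × List Bool) × (ℕ × ℕ) => (z.1, z.2.1)) :=
      fst.pair (fst.comp snd)
    exact nat_add.comp (nat_mul.comp (Primrec.const 2) (snd.comp snd))
      (nat_add.comp ((cap_prim true).comp ha) ((cap_prim false).comp ha))

theorem pow2_prim : Primrec (fun n : ℕ => 2 ^ n) := by
  refine (Primrec.nat_rec' (f := fun n : ℕ => n) (g := fun _ => 1) (h := fun _ q => q.2 * 2)
    Primrec.id (Primrec.const 1)
    (Primrec.nat_mul.comp (Primrec.snd.comp Primrec.snd) (Primrec.const 2))).of_eq fun n => ?_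
  induction n with
  | zero => rfl
  | succ n ih => rw [pow_succ, ← ih]

/-- gcd by search -/
def sgcd (a c : ℕ) : ℕ := Nat.findGreatest (fun d => a % d = 0 ∧ c % d = 0) a

theorem sgcd_eq {a c : ℕ} (h : 0 < a) : sgcd a c = Nat.gcd a c := by
  unfold sgcd
  apply le_antisymm
  · have h0 : Nat.findGreatest (fun d => a % d = 0 ∧ c % d = 0) a ≠ 0 := by
      have : 1 ≤ Nat.findGreatest (fun d => a % d = 0 ∧ c % d = 0) a :=
        Nat.le_findGreatest h (by simp [Nat.mod_one])
      omega
    have := Nat.findGreatest_of_ne_zero (P := fun d => a % d = 0 ∧ c % d = 0) rfl h0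
    exact Nat.le_of_dvd (Nat.gcd_pos_of_pos_left _ h)
      (Nat.dvd_gcd (Nat.dvd_of_mod_eq_zero this.1) (Nat.dvd_of_mod_eq_zero this.2))
  · exact Nat.le_findGreatest (Nat.gcd_le_left _ h)
      ⟨Nat.mod_eq_zero_of_dvd (Nat.gcd_dvd_left _ _), Nat.mod_eq_zero_of_dvd (Nat.gcd_dvd_right _ _)⟩

theorem sgcd_prim : Primrec₂ sgcd := by
  refine Primrec.nat_findGreatest (f := fun p : ℕ × ℕ => p.1)
    (p := fun (p : ℕ × ℕ) d => p.1 % d = 0 ∧ p.2 % d = 0) Primrec.fst ?_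
  refine PrimrecPred.and ?_ ?_
  · exact Primrec.eq.comp (Primrec.nat_mod.comp (Primrec.fst.comp Primrec.fst) Primrec.snd)
      (Primrec.const 0)
  · exact Primrec.eq.comp (Primrec.nat_mod.comp (Primrec.snd.comp Primrec.fst) Primrec.snd)
      (Primrec.const 0)

/-- code of the rational `a / c` -/
def ratCode (a c : ℕ) : ℕ := Nat.pair (2 * (a / sgcd a c)) (c / sgcd a c)

theorem ratCode_prim : Primrec₂ ratCode :=
  Primrec₂.natPair.comp
    (Primrec.nat_mul.comp (Primrec.const 2) (Primrec.nat_div.comp Primrec.fst sgcd_prim))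
    (Primrec.nat_div.comp Primrec.snd sgcd_prim)

theorem encode_rat (q : ℚ) : Encodable.encode q = Nat.pair (Encodable.encode q.num) q.den := rfl

theorem encode_int (n : ℕ) : Encodable.encode (n : ℤ) = 2 * n := rfl

theorem encode_ratCode {a c : ℕ} (ha : 0 < a) (hc : 0 < c) :
    Encodable.encode ((a : ℚ) / (c : ℚ)) = ratCode a c := by
  have hg : 0 < Nat.gcd a c := Nat.gcd_pos_of_pos_left _ ha
  have hcg : 0 < c / Nat.gcd a c := Nat.div_pos (Nat.gcd_le_right _ hc) hg
  have hcop : Nat.Coprime (a / Nat.gcd a c) (c / Nat.gcd a c) := Nat.coprime_div_gcd_div_gcd hg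
  have heq : (a : ℚ) / (c : ℚ) =
      (((a / Nat.gcd a c : ℕ) : ℤ) : ℚ) / (((c / Nat.gcd a c : ℕ) : ℤ) : ℚ) := by
    have h1 : (a : ℚ) = (Nat.gcd a c : ℚ) * ((a / Nat.gcd a c : ℕ) : ℚ) := by
      exact_mod_cast (Nat.mul_div_cancel' (Nat.gcd_dvd_left a c)).symm
    have h2 : (c : ℚ) = (Nat.gcd a c : ℚ) * ((c / Nat.gcd a c : ℕ) : ℚ) := by
      exact_mod_cast (Nat.mul_div_cancel' (Nat.gcd_dvd_right a c)).symm
    have hg' : (Nat.gcd a c : ℚ) ≠ 0 := by exact_mod_cast hg.ne'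
    conv_lhs => rw [h1, h2]
    rw [mul_div_mul_left _ _ hg']
    push_cast
    rfl
  have hn := Rat.num_div_eq_of_coprime (a := ((a / Nat.gcd a c : ℕ) : ℤ))
    (b := ((c / Nat.gcd a c : ℕ) : ℤ)) (by exact_mod_cast hcg) (by simpa only [Int.natAbs_natCast] using hcop)
  have hd := Rat.den_div_eq_of_coprime (a := ((a / Nat.gcd a c : ℕ) : ℤ))
    (b := ((c / Nat.gcd a c : ℕ) : ℤ)) (by exact_mod_cast hcg) (by simpa only [Int.natAbs_natCast] using hcop)
  rw [encode_rat, heq, hn, encode_int, ratCode, sgcd_eq ha]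
  congr 1
  exact_mod_cast hd

theorem cap_congr {b b' : ℕ → ℕ} {i : Bool} {e : ℕ} {σ : List Bool} {n : ℕ}
    (h : ∀ x < n, b (Nat.pair e x) = b' (Nat.pair e x)) : cap b i e σ n = cap b' i e σ n := by
  induction n with
  | zero => rfl
  | succ n ih => rw [cap_succ, cap_succ, ih fun x hx => h x (by omega), h n (by omega)]

theorem capU_congr {b b' : ℕ → ℕ} {σ : List Bool} {n : ℕ}
    (h : ∀ e < n, ∀ x < σ.length, b (Nat.pair e x) = b' (Nat.pair e x)) :
    capU b σ n = capU b' σ n := by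
  induction n with
  | zero => rfl
  | succ n ih =>
    rw [capU_succ, capU_succ, ih fun e he => h e (by omega), cap_congr (h n (by omega)),
      cap_congr (h n (by omega))]

open Encodable Denumerable in
theorem mart_rt {A : Set ℕ} {b : ℕ → ℕ} (hb : RT (chi A) b) : FRed (mart b) A := by
  let bd : ℕ → ℕ := fun n => ((decode (α := List Bool) n).map
    fun σ => Nat.pair σ.length σ.length).getD 0
  have hbd : Primrec bd := by
    refine Primrec.option_getD.comp (Primrec.option_map Primrec.decode ?_) (Primrec.const 0)
    exact Primrec₂.natPair.comp (Primrec.list_length.comp Primrec.snd)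
      (Primrec.list_length.comp Primrec.snd)
  let H : ℕ → ℕ → ℕ := fun lc n => encode ((decode (α := List Bool) n).map
    fun σ => ratCode (capU (lk (ofNat (List ℕ) lc)) σ σ.length + 2) (2 ^ σ.length))
  have hH : Primrec₂ H := by
    refine Primrec.encode.comp (Primrec.option_map (Primrec.decode.comp Primrec.snd) ?_)
    refine ratCode_prim.comp (Primrec.nat_add.comp ?_ (Primrec.const 2))
      (pow2_prim.comp (Primrec.list_length.comp Primrec.snd))
    exact capU_prim.comp (((Primrec.ofNat (List ℕ)).comp (Primrec.fst.comp Primrec.fst)).pair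
      Primrec.snd)
  have := RT.map₂ hH (RT.comp (RT.pre hb) (RT.of_prim hbd)) (RT.of_prim Primrec.id)
  refine RecIn.of_eq this fun n => ?_
  congr 1
  simp only [fnOracle, H, bd, id, ofNat_encode]
  rcases decode (α := List Bool) n with _ | σ
  · rfl
  · simp only [Option.map_some, Option.getD_some, encode_some]
    have h1 : capU (lk (pre b (Nat.pair σ.length σ.length))) σ σ.length = capU b σ σ.length := by
      refine capU_congr fun e he x hx => ?_
      have : Nat.pair e x < Nat.pair σ.length σ.length :=
        (Nat.pair_lt_pair_left _ he).trans (Nat.pair_lt_pair_right _ hx)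
      rw [lk, pre_get b this]
      rfl
    rw [h1, ← encode_ratCode (by omega) (by positivity)]
    rfl

/-- For every set `D ≤_T ∅'` with `∅' ≰_T D`, there is a `∅'`-computable
martingale succeeding on every set having an infinite subset or cosubset computable
in `D`; in particular, the class of `Δ⁰₂` sets having an infinite subset or cosubset
of degree at most `deg(D)` is `Δ⁰₂` null. -/
theorem stmt0 (D : Set ℕ) (hD : TRed D K) (hD' : ¬ TRed K D) :
    ∃ M : List Bool → ℚ, IsMartingale M ∧ FRed M K ∧
      ∀ A : Set ℕ,
        (∃ S : Set ℕ, S.Infinite ∧ (S ⊆ A ∨ S ⊆ Aᶜ) ∧ TRed S D) →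
        Succeeds M A := by
  refine ⟨mart (bet D), mart_isMartingale fun e x h => bet_lt h, mart_rt (bet_rt hD), ?_⟩
  rintro A ⟨S, hi, hsub, hS⟩
  obtain ⟨e, h1, h2⟩ := bet_complete hD' hS hi
  rcases hsub with hA | hA
  · exact mart_succeeds (i := true) (fun x hx => if_pos (hA (h1 x hx))) h2
  · exact mart_succeeds (i := false) (fun x hx => if_neg (hA (h1 x hx))) h2
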